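/- Let E ⊆ ℝⁿ be a bounded measurable set. A family 𝓕 of measurable real-valued functions on E is totally bounded in the topology of convergence in measure if and only if 𝓕 is almost equibounded and almost equicontinuous. -/

import Mathlib

open MeasureTheory ENNReal

/-- Almost equicontinuity of a family of functions on a set E. -/
def AlmostEquicontinuous {n : ℕ} (E : Set (EuclideanSpace ℝ (Fin n)))
    (F : Set (EuclideanSpace ℝ (Fin n) → ℝ)) : Prop :=
  ∀ ε > (0 : ℝ), ∃ δ > (0 : ℝ), ∀ f ∈ F, ∃ B ⊆ E,
    volume B < ENNReal.ofReal ε ∧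
    ∀ x₁ ∈ E \ B, ∀ x₂ ∈ E \ B, ‖x₁ - x₂‖ < δ → |f x₁ - f x₂| < ε

/-- Almost equiboundedness of a family of functions on a set E. -/
def AlmostEquibounded {n : ℕ} (E : Set (EuclideanSpace ℝ (Fin n)))
    (F : Set (EuclideanSpace ℝ (Fin n) → ℝ)) : Prop :=
  ∀ ε > (0 : ℝ), ∃ M > (0 : ℝ), ∀ f ∈ F,
    volume {x ∈ E | M < |f x|} < ENNReal.ofReal ε

open Filter Topology in
theorem exists_hasCompactSupport_lintegral_min_abs_sub_lt {α : Type*} [TopologicalSpace α]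
    [T4Space α] [WeaklyLocallyCompactSpace α] [MeasurableSpace α] [BorelSpace α] {μ : Measure α}
    [IsFiniteMeasure μ] [μ.Regular] {g : α → ℝ} (hg : Measurable g) {ε : ℝ≥0∞} (hε : ε ≠ 0) :
    ∃ h : α → ℝ, HasCompactSupport h ∧ Continuous h ∧
      ∫⁻ x, ENNReal.ofReal (min |g x - h x| 1) ∂μ < ε := by
  let T : ℕ → α → ℝ := fun k x => max (-(k : ℝ)) (min (g x) k)
  have hT : ∀ k, Measurable (T k) := fun k => by fun_prop
  have hlim : Tendsto (fun k => ∫⁻ x, ENNReal.ofReal (min |g x - T k x| 1) ∂μ) atTop (𝓝 0) := by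
    have := tendsto_lintegral_of_dominated_convergence (μ := μ)
      (F := fun k x => ENNReal.ofReal (min |g x - T k x| 1)) (f := fun _ => 0) (fun _ => 1)
      (fun k => by have := hT k; fun_prop) (fun k => ae_of_all _ fun x => by simp)
      (by simp) (ae_of_all _ fun x => by
        refine tendsto_const_nhds.congr' ?_
        obtain ⟨N, hN⟩ := exists_nat_ge |g x|
        filter_upwards [eventually_ge_atTop N] with k hk
        have hk' : |g x| ≤ k := hN.trans (by exact_mod_cast hk)
        have : T k x = g x := by
          simp only [T]
          rw [min_eq_left (abs_le.1 hk').2, max_eq_right (abs_le.1 hk').1]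
        simp [this])
    simpa using this
  have hε3 : 0 < ε / 3 := ENNReal.div_pos hε (by simp)
  wlog hεt : ε ≠ ∞ generalizing ε
  · obtain ⟨h, h1, h2, h3⟩ := this (ε := 1) (by simp) (by simp) (by simp)
    exact ⟨h, h1, h2, h3.trans (by simp_all)⟩
  obtain ⟨k, hk⟩ := (hlim.eventually_lt_const hε3).exists
  have hint : Integrable (T k) μ :=
    Integrable.of_bound (hT k).aestronglyMeasurable (k : ℝ) (ae_of_all _ fun x => by
      have hk0 : (0 : ℝ) ≤ k := k.cast_nonneg
      rw [Real.norm_eq_abs, abs_le]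
      exact ⟨le_max_left _ _, max_le (by linarith) (min_le_right _ _)⟩)
  obtain ⟨h, hc, hle, hcont, -⟩ := hint.exists_hasCompactSupport_lintegral_sub_le hε3.ne'
  refine ⟨h, hc, hcont, ?_⟩
  calc ∫⁻ x, ENNReal.ofReal (min |g x - h x| 1) ∂μ
      ≤ ∫⁻ x, (ENNReal.ofReal (min |g x - T k x| 1) + ‖T k x - h x‖ₑ) ∂μ := by
        refine lintegral_mono fun x => ?_
        rw [Real.enorm_eq_ofReal_abs, ← ENNReal.ofReal_add (by positivity) (by positivity)]
        refine ENNReal.ofReal_le_ofReal ?_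
        have h1 := abs_sub_le (g x) (T k x) (h x)
        have h2 := abs_nonneg (T k x - h x)
        rcases le_total |g x - T k x| 1 with h3 | h3
        · rw [min_eq_left h3]; exact (min_le_left _ _).trans h1
        · rw [min_eq_right h3]; exact (min_le_right _ _).trans (by linarith)
    _ = ∫⁻ x, ENNReal.ofReal (min |g x - T k x| 1) ∂μ + ∫⁻ x, ‖T k x - h x‖ₑ ∂μ :=
        lintegral_add_left (by have := hT k; fun_prop) _
    _ < ε / 3 + ε / 3 + ε / 3 := by
        have hne : ε / 3 ≠ ∞ := (ENNReal.div_lt_top hεt (by simp)).ne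
        calc _ < ε / 3 + ε / 3 := ENNReal.add_lt_add_of_lt_of_le (ne_top_of_le_ne_top hne hle) hk hle
          _ ≤ _ := le_self_add
    _ = ε := ENNReal.add_thirds ε

theorem measure_le_abs_sub_lt {α : Type*} [MeasurableSpace α] {μ : Measure α} {f g : α → ℝ}
    (hf : Measurable f) (hg : Measurable g) {a b : ℝ} (ha : 0 < a) (ha1 : a ≤ 1)
    (h : ∫⁻ x, ENNReal.ofReal (min |f x - g x| 1) ∂μ < ENNReal.ofReal (a * b)) :
    μ {x | a ≤ |f x - g x|} < ENNReal.ofReal b := by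
  have hM := mul_meas_ge_le_lintegral (μ := μ)
    (f := fun x => ENNReal.ofReal (min |f x - g x| 1)) (by fun_prop) (ENNReal.ofReal a)
  have hsub : {x | a ≤ |f x - g x|} ⊆
      {x | ENNReal.ofReal a ≤ ENNReal.ofReal (min |f x - g x| 1)} := fun x hx =>
    ENNReal.ofReal_le_ofReal (le_min hx ha1)
  refine (measure_mono hsub).trans_lt ?_
  rw [ENNReal.ofReal_mul ha.le] at h
  exact lt_of_mul_lt_mul_left' (hM.trans_lt h)

theorem lintegral_min_abs_sub_le {α : Type*} [MeasurableSpace α] {μ : Measure α} {E B : Set α}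
    (hE : MeasurableSet E) {f g : α → ℝ} {c : ℝ} (h : ∀ x ∈ E \ B, |f x - g x| ≤ c) :
    ∫⁻ x in E, ENNReal.ofReal (min |f x - g x| 1) ∂μ ≤ ENNReal.ofReal c * μ E + μ B := by
  calc ∫⁻ x in E, ENNReal.ofReal (min |f x - g x| 1) ∂μ
      ≤ ∫⁻ x in E, (ENNReal.ofReal c + (toMeasurable μ B).indicator 1 x) ∂μ := by
        refine setLIntegral_mono' hE fun x hx => ?_
        by_cases hB : x ∈ B
        · rw [Set.indicator_of_mem (subset_toMeasurable μ B hB)]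
          refine le_trans ?_ le_add_self
          simp
        · refine le_trans ?_ le_self_add
          exact ENNReal.ofReal_le_ofReal ((min_le_left _ _).trans (h x ⟨hx, hB⟩))
    _ = ENNReal.ofReal c * μ E + μ.restrict E (toMeasurable μ B) := by
        rw [lintegral_add_left measurable_const, lintegral_indicator_one
          (measurableSet_toMeasurable μ B)]
        simp
    _ ≤ ENNReal.ofReal c * μ E + μ B :=
        add_le_add le_rfl ((Measure.restrict_apply_le _ _).trans (measure_toMeasurable B).le)

theorem exists_simpleFunc_dist_lt {α : Type*} [PseudoMetricSpace α] [ProperSpace α] [Nonempty α]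
    [MeasurableSpace α] [OpensMeasurableSpace α] {E : Set α} (hE : Bornology.IsBounded E)
    {δ : ℝ} (hδ : 0 < δ) : ∃ p : SimpleFunc α α, ∀ x ∈ E, dist (p x) x < δ := by
  obtain ⟨t, ht⟩ := hE.isCompact_closure.elim_finite_subcover
    (fun k : ℕ => Metric.ball (TopologicalSpace.denseSeq α k) δ) (fun _ => Metric.isOpen_ball)
    (fun x _ => by
      obtain ⟨k, hk⟩ := (TopologicalSpace.denseRange_denseSeq α).exists_dist_lt x hδ
      exact Set.mem_iUnion.2 ⟨k, hk⟩)
  refine ⟨SimpleFunc.nearestPt (TopologicalSpace.denseSeq α) (t.sup id), fun x hx => ?_⟩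
  obtain ⟨k, hkt, hk⟩ := Set.mem_iUnion₂.1 (ht (subset_closure hx))
  have := SimpleFunc.edist_nearestPt_le (TopologicalSpace.denseSeq α) x
    (Finset.le_sup (f := id) hkt)
  rw [edist_dist, edist_dist, ENNReal.ofReal_le_ofReal_iff dist_nonneg] at this
  rw [Metric.mem_ball, dist_comm] at hk
  exact this.trans_lt hk

theorem exists_continuous_net {α : Type*} [TopologicalSpace α]
    [T4Space α] [WeaklyLocallyCompactSpace α] [MeasurableSpace α] [BorelSpace α] {μ : Measure α}
    [IsFiniteMeasure μ] [μ.Regular] {F : Set (α → ℝ)} (hF : ∀ f ∈ F, Measurable f)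
    (h : ∀ ε > (0 : ℝ), ∃ G : Set (α → ℝ), G.Finite ∧ (∀ g ∈ G, Measurable g) ∧
      ∀ f ∈ F, ∃ g ∈ G, ∫⁻ x, ENNReal.ofReal (min |f x - g x| 1) ∂μ < ENNReal.ofReal ε)
    {ε : ℝ} (hε : 0 < ε) :
    ∃ G : Set (α → ℝ), G.Finite ∧ (∀ g ∈ G, HasCompactSupport g ∧ Continuous g) ∧
      ∀ f ∈ F, ∃ g ∈ G, ∫⁻ x, ENNReal.ofReal (min |f x - g x| 1) ∂μ < ENNReal.ofReal ε := by
  obtain ⟨G, hGfin, hG, hFG⟩ := h (ε / 2) (half_pos hε)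
  have hε' : ENNReal.ofReal (ε / 2) ≠ 0 := by simpa using hε
  choose! φ hφ1 hφ2 hφ3 using fun g (hg : g ∈ G) =>
    exists_hasCompactSupport_lintegral_min_abs_sub_lt (μ := μ) (hG g hg) hε'
  refine ⟨φ '' G, hGfin.image φ, ?_, fun f hf => ?_⟩
  · rintro _ ⟨g, hg, rfl⟩
    exact ⟨hφ1 g hg, hφ2 g hg⟩
  obtain ⟨g, hg, hfg⟩ := hFG f hf
  refine ⟨φ g, ⟨g, hg, rfl⟩, ?_⟩
  have hfm := hF f hf
  have hgm := hG g hg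
  calc ∫⁻ x, ENNReal.ofReal (min |f x - φ g x| 1) ∂μ
      ≤ ∫⁻ x, (ENNReal.ofReal (min |f x - g x| 1) + ENNReal.ofReal (min |g x - φ g x| 1)) ∂μ := by
        refine lintegral_mono fun x => ?_
        rw [← ENNReal.ofReal_add (by positivity) (by positivity)]
        refine ENNReal.ofReal_le_ofReal ?_
        have h1 := abs_sub_le (f x) (g x) (φ g x)
        have h2 := abs_nonneg (f x - g x)
        have h3 := abs_nonneg (g x - φ g x)
        rcases le_total |f x - g x| 1 with h4 | h4 <;>
          rcases le_total |g x - φ g x| 1 with h5 | h5 <;>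
          simp only [h4, h5, min_eq_left, min_eq_right] <;>
          first
            | exact (min_le_left _ _).trans h1
            | exact (min_le_right _ _).trans (by linarith)
    _ = ∫⁻ x, ENNReal.ofReal (min |f x - g x| 1) ∂μ +
          ∫⁻ x, ENNReal.ofReal (min |g x - φ g x| 1) ∂μ :=
        lintegral_add_left (by fun_prop) _
    _ < ENNReal.ofReal (ε / 2) + ENNReal.ofReal (ε / 2) := ENNReal.add_lt_add hfg (hφ3 g hg)
    _ = ENNReal.ofReal ε := by
        rw [← ENNReal.ofReal_add (by positivity) (by positivity), add_halves]

theorem almostEquibounded_of_totallyBounded {n : ℕ} {E : Set (EuclideanSpace ℝ (Fin n))}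
    (hE : MeasurableSet E) {F : Set (EuclideanSpace ℝ (Fin n) → ℝ)}
    (hmeas : ∀ f ∈ F, Measurable f)
    (h : ∀ ε > (0 : ℝ), ∃ G : Set (EuclideanSpace ℝ (Fin n) → ℝ), G.Finite ∧
      (∀ g ∈ G, HasCompactSupport g ∧ Continuous g) ∧ ∀ f ∈ F, ∃ g ∈ G,
        ∫⁻ x in E, ENNReal.ofReal (min |f x - g x| 1) < ENNReal.ofReal ε) :
    AlmostEquibounded E F := by
  intro ε hε
  obtain ⟨G, hGfin, hG, hFG⟩ := h ε hε
  choose! C hC using fun g (hg : g ∈ G) => (hG g hg).2.bounded_above_of_compact_support (hG g hg).1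
  obtain ⟨M, hM⟩ := (hGfin.image C).bddAbove
  refine ⟨max M 0 + 1, by positivity, fun f hf => ?_⟩
  obtain ⟨g, hg, hfg⟩ := hFG f hf
  have hlt := measure_le_abs_sub_lt (hmeas f hf) (hG g hg).2.measurable one_pos le_rfl
    (b := ε) (by simpa using hfg)
  rw [Measure.restrict_apply' hE] at hlt
  refine lt_of_le_of_lt (measure_mono ?_) hlt
  refine fun x hx => ⟨?_, hx.1⟩
  have h1 : |g x| ≤ M := (hC g hg x).trans (hM ⟨g, hg, rfl⟩)
  have h2 := hx.2
  have h3 := abs_sub_abs_le_abs_sub (f x) (g x)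
  have h4 := le_max_left M 0
  change 1 ≤ |f x - g x|
  linarith

theorem almostEquicontinuous_of_totallyBounded {n : ℕ} {E : Set (EuclideanSpace ℝ (Fin n))}
    (hE : MeasurableSet E) {F : Set (EuclideanSpace ℝ (Fin n) → ℝ)}
    (hmeas : ∀ f ∈ F, Measurable f)
    (h : ∀ ε > (0 : ℝ), ∃ G : Set (EuclideanSpace ℝ (Fin n) → ℝ), G.Finite ∧
      (∀ g ∈ G, HasCompactSupport g ∧ Continuous g) ∧ ∀ f ∈ F, ∃ g ∈ G,
        ∫⁻ x in E, ENNReal.ofReal (min |f x - g x| 1) < ENNReal.ofReal ε) :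
    AlmostEquicontinuous E F := by
  intro ε hε
  set a : ℝ := min (ε / 3) 1 with ha_def
  have ha : 0 < a := lt_min (by positivity) one_pos
  have haε : a ≤ ε / 3 := min_le_left _ _
  obtain ⟨G, hGfin, hG, hFG⟩ := h (a * ε) (by positivity)
  have huc : ∀ᶠ δ in nhdsWithin (0 : ℝ) (Set.Ioi 0), ∀ g ∈ G, ∀ x y,
      dist x y < δ → dist (g x) (g y) < ε / 3 := by
    rw [Filter.eventually_all_finite hGfin]
    intro g hg
    obtain ⟨δ, hδ, hgδ⟩ := Metric.uniformContinuous_iff.1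
      ((hG g hg).1.uniformContinuous_of_continuous (hG g hg).2) (ε / 3) (by positivity)
    filter_upwards [Ioo_mem_nhdsGT hδ] with η hη x y hxy
    exact hgδ (hxy.trans hη.2)
  obtain ⟨δ, hδ, hδ0⟩ := (huc.and self_mem_nhdsWithin).exists
  refine ⟨δ, hδ0, fun f hf => ?_⟩
  obtain ⟨g, hg, hfg⟩ := hFG f hf
  have hlt := measure_le_abs_sub_lt (hmeas f hf) (hG g hg).2.measurable ha (min_le_right _ _) hfg
  rw [Measure.restrict_apply' hE] at hlt
  refine ⟨_, Set.inter_subset_right, hlt, fun x hx y hy hxy => ?_⟩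
  have h1 : |f x - g x| < a := not_le.1 fun H => hx.2 ⟨H, hx.1⟩
  have h2 : |f y - g y| < a := not_le.1 fun H => hy.2 ⟨H, hy.1⟩
  have h3 := hδ g hg x y (by rwa [dist_eq_norm])
  rw [Real.dist_eq] at h3
  rw [abs_lt] at *
  constructor <;> linarith

theorem exists_finite_net_of_almostEquibounded_of_almostEquicontinuous {n : ℕ}
    {E : Set (EuclideanSpace ℝ (Fin n))} (hE : MeasurableSet E) (hEbd : Bornology.IsBounded E)
    {F : Set (EuclideanSpace ℝ (Fin n) → ℝ)} (hb : AlmostEquibounded E F)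
    (hc : AlmostEquicontinuous E F) {ε : ℝ} (hε : 0 < ε) :
    ∃ G : Set (EuclideanSpace ℝ (Fin n) → ℝ), G.Finite ∧ (∀ g ∈ G, Measurable g) ∧
      ∀ f ∈ F, ∃ g ∈ G,
        ∫⁻ x in E, ENNReal.ofReal (min |f x - g x| 1) < ENNReal.ofReal ε := by
  set V : ℝ := (volume E).toReal with hV
  have hV0 : 0 ≤ V := ENNReal.toReal_nonneg
  have hVE : volume E = ENNReal.ofReal V := (ENNReal.ofReal_toReal hEbd.measure_lt_top.ne).symm
  set η : ℝ := ε / (2 * V + 2) with hη_def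
  have hη : 0 < η := by positivity
  obtain ⟨M, -, hM⟩ := hb η hη
  obtain ⟨δ, hδ, hFδ⟩ := hc η hη
  obtain ⟨p, hp⟩ := exists_simpleFunc_dist_lt hEbd (half_pos hδ)
  obtain ⟨S, -, hSfin, hS⟩ := (isCompact_Icc (a := -M) (b := M)).finite_cover_balls hη
  have := hSfin.to_subtype
  let Φ : (p.range → Option S) → EuclideanSpace ℝ (Fin n) → ℝ := fun c x =>
    (c ⟨p x, p.mem_range_self x⟩).elim 0 (↑)
  refine ⟨Set.range Φ, Set.finite_range Φ, ?_, fun f hf => ?_⟩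
  · rintro _ ⟨c, rfl⟩
    exact (measurable_of_countable fun y : p.range => (c y).elim (0 : ℝ) (↑)).comp
      (p.measurable.subtype_mk)
  obtain ⟨B, -, hBvol, hB⟩ := hFδ f hf
  set D := B ∪ {x ∈ E | M < |f x|} with hD
  have hchoice : ∀ y : p.range, ∃ c : Option S, ∀ x ∈ E \ D, p x = y →
      |f x - c.elim 0 (↑)| ≤ 2 * η := by
    intro y
    by_cases hy : ∃ x ∈ E \ D, p x = y
    · obtain ⟨x₀, hx₀, hpx₀⟩ := hy
      have hfx₀ : f x₀ ∈ Set.Icc (-M) M :=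
        abs_le.1 (not_lt.1 fun H => hx₀.2 (Or.inr ⟨hx₀.1, H⟩))
      obtain ⟨s, hs, hfs⟩ := Set.mem_iUnion₂.1 (hS hfx₀)
      refine ⟨some ⟨s, hs⟩, fun x hx hpx => ?_⟩
      have hd : ‖x - x₀‖ < δ := by
        have h1 := hp x hx.1
        have h2 := hp x₀ hx₀.1
        rw [hpx, dist_comm] at h1
        rw [hpx₀] at h2
        rw [← dist_eq_norm]
        linarith [dist_triangle x y.1 x₀]
      have h1 := hB x ⟨hx.1, fun H => hx.2 (Or.inl H)⟩ x₀ ⟨hx₀.1, fun H => hx₀.2 (Or.inl H)⟩ hd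
      rw [Metric.mem_ball, Real.dist_eq] at hfs
      have h2 := abs_sub_le (f x) (f x₀) s
      change |f x - s| ≤ 2 * η
      linarith
    · exact ⟨none, fun x hx hpx => (hy ⟨x, hx, hpx⟩).elim⟩
  choose c hcf using hchoice
  refine ⟨Φ c, ⟨c, rfl⟩, ?_⟩
  refine (lintegral_min_abs_sub_le (B := D) (c := 2 * η) hE
    fun x hx => hcf ⟨p x, p.mem_range_self x⟩ x hx rfl).trans_lt ?_
  calc ENNReal.ofReal (2 * η) * volume E + volume D
      < ENNReal.ofReal (2 * η) * volume E + (ENNReal.ofReal η + ENNReal.ofReal η) := by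
        refine ENNReal.add_lt_add_left
          (ENNReal.mul_ne_top ENNReal.ofReal_ne_top hEbd.measure_lt_top.ne) ?_
        exact (measure_union_le _ _).trans_lt (ENNReal.add_lt_add hBvol (hM f hf))
    _ = ENNReal.ofReal ε := by
        rw [hVE, ← ENNReal.ofReal_mul (by positivity), ← ENNReal.ofReal_add hη.le hη.le,
          ← ENNReal.ofReal_add (by positivity) (by positivity)]
        congr 1
        rw [hη_def]
        field_simp
        ring

theorem totallyBounded_in_measure_iff {n : ℕ}
    (E : Set (EuclideanSpace ℝ (Fin n))) (hE : MeasurableSet E)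
    (hEbd : Bornology.IsBounded E)
    (F : Set (EuclideanSpace ℝ (Fin n) → ℝ))
    (hmeas : ∀ f ∈ F, Measurable f) :
    (∀ ε > (0 : ℝ), ∃ G : Set (EuclideanSpace ℝ (Fin n) → ℝ), G.Finite ∧
      (∀ g ∈ G, Measurable g) ∧
      ∀ f ∈ F, ∃ g ∈ G,
        (∫⁻ x in E, ENNReal.ofReal (min |f x - g x| 1)) < ENNReal.ofReal ε) ↔
    (AlmostEquibounded E F ∧ AlmostEquicontinuous E F) := by
  have : IsFiniteMeasure (volume.restrict E) := ⟨by simpa using hEbd.measure_lt_top⟩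
  constructor
  · intro h
    have hnet := fun ε (hε : ε > (0 : ℝ)) => exists_continuous_net hmeas h hε
    exact ⟨almostEquibounded_of_totallyBounded hE hmeas hnet,
      almostEquicontinuous_of_totallyBounded hE hmeas hnet⟩
  · rintro ⟨hb, hc⟩ ε hε
    exact exists_finite_net_of_almostEquibounded_of_almostEquicontinuous hE hEbd hb hc hε
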